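/- arXiv:2405.20262 — 2 statements merged into one kernel-verified Lean document; each statement's English description precedes it below -/
import Mathlib

section
/- Fix N ≥ 0. Define polynomials P_1,...,P_n ∈ Pol_n recursively by P_1 = X_1^N and P_{r+1} = -∂_r(P_r), and set d_N = Σ_{i=1}^n P_i ω_i^- as an operator on EPol_n. Then d_N commutes with every Demazure operator ∂_r (1 ≤ r ≤ n-1) and with every multiplication operator X_i, and satisfies d_N ∘ d_N = 0. -/
open MvPolynomial
open scoped TensorProduct

noncomputable section

abbrev EPol (k : Type) [Field k] (n : ℕ) :=
  TensorProduct k (MvPolynomial (Fin n) k) (ExteriorAlgebra k (Fin n → k))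

def XE (k : Type) [Field k] (n : ℕ) (i : Fin n) : EPol k n := (X i) ⊗ₜ[k] 1

def wE (k : Type) [Field k] (n : ℕ) (i : Fin n) : EPol k n :=
  1 ⊗ₜ[k] (ExteriorAlgebra.ι k (Pi.single i (1 : k)))

def PE (k : Type) [Field k] (n : ℕ) (P : MvPolynomial (Fin n) k) : EPol k n := P ⊗ₜ[k] 1

def fr (n r : ℕ) (hr : r + 1 < n) : Fin n := ⟨r, Nat.lt_of_succ_lt hr⟩
def fr1 (n r : ℕ) (hr : r + 1 < n) : Fin n := ⟨r + 1, hr⟩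


theorem E_neg_mul (k : Type) [Field k] (n : ℕ) (x y : EPol k n) : -x * y = -(x * y) :=
  neg_mul x y

theorem E_mul_neg (k : Type) [Field k] (n : ℕ) (x y : EPol k n) : x * -y = -(x * y) :=
  mul_neg x y

theorem PE_mul (k : Type) [Field k] (n : ℕ) (P Q : MvPolynomial (Fin n) k) :
    PE k n (P * Q) = PE k n P * PE k n Q := by
  simp [PE]

theorem PE_sub (k : Type) [Field k] (n : ℕ) (P Q : MvPolynomial (Fin n) k) :
    PE k n (P - Q) = PE k n P - PE k n Q := by
  simp [PE, TensorProduct.sub_tmul]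

theorem PE_add (k : Type) [Field k] (n : ℕ) (P Q : MvPolynomial (Fin n) k) :
    PE k n (P + Q) = PE k n P + PE k n Q := by
  simp [PE, TensorProduct.add_tmul]

theorem PE_X (k : Type) [Field k] (n : ℕ) (i : Fin n) : XE k n i = PE k n (X i) := rfl

theorem PE_smul (k : Type) [Field k] (n : ℕ) (P : MvPolynomial (Fin n) k) (x : EPol k n) :
    PE k n P * x = P • x := by
  induction x using TensorProduct.induction_on with
  | zero => simp
  | tmul Q y => simp [PE, TensorProduct.smul_tmul']
  | add x y hx hy => rw [mul_add, hx, hy, smul_add]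

theorem PE_comm (k : Type) [Field k] (n : ℕ) (P : MvPolynomial (Fin n) k) (x : EPol k n) :
    PE k n P * x = x * PE k n P := by
  induction x using TensorProduct.induction_on with
  | zero => simp
  | tmul Q y => simp [PE, mul_comm]
  | add x y hx hy => rw [mul_add, hx, hy, add_mul]

theorem PE_cancel (k : Type) [Field k] (n : ℕ) (P : MvPolynomial (Fin n) k) (hP : P ≠ 0)
    (x y : EPol k n) (h : PE k n P * x = PE k n P * y) : x = y := by
  rw [PE_smul, PE_smul] at h
  exact smul_right_injective _ hP h

theorem EPol_ind (k : Type) [Field k] (n : ℕ) (M : EPol k n → Prop)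
    (hP : ∀ P, M (PE k n P)) (hw : ∀ i, M (wE k n i))
    (hadd : ∀ x y, M x → M y → M (x + y)) (hmul : ∀ x y, M x → M y → M (x * y))
    (x : EPol k n) : M x := by
  have h0 : M 0 := by simpa [PE] using hP 0
  induction x using TensorProduct.induction_on with
  | zero => exact h0
  | add x y hx hy => exact hadd _ _ hx hy
  | tmul Q y =>
    have : Q ⊗ₜ[k] y = PE k n Q * ((1 : MvPolynomial (Fin n) k) ⊗ₜ[k] y) := by simp [PE]
    rw [this]
    refine hmul _ _ (hP Q) ?_
    induction y using ExteriorAlgebra.induction with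
    | algebraMap r =>
      have : (1 : MvPolynomial (Fin n) k) ⊗ₜ[k] (algebraMap k (ExteriorAlgebra k (Fin n → k)) r)
          = PE k n (C r) := by
        rw [Algebra.algebraMap_eq_smul_one, ← TensorProduct.smul_tmul, PE,
          MvPolynomial.C_eq_smul_one]
      rw [this]; exact hP _
    | ι v =>
      have : (1 : MvPolynomial (Fin n) k) ⊗ₜ[k] (ExteriorAlgebra.ι k v)
          = ∑ i, PE k n (C (v i)) * wE k n i := by
        conv_lhs => rw [pi_eq_sum_univ' v]
        rw [map_sum, TensorProduct.tmul_sum]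
        refine Finset.sum_congr rfl fun i _ => ?_
        have e : (fun j => if i = j then (1 : k) else 0) = Pi.single i 1 := by
          ext j; simp [Pi.single_apply, eq_comm]
        rw [PE_smul, wE, map_smul, TensorProduct.smul_tmul', MvPolynomial.C_eq_smul_one,
          ← TensorProduct.smul_tmul]
        simp [← e]
      rw [this]
      exact Finset.sum_induction _ M hadd h0 fun i _ => hmul _ _ (hP _) (hw i)
    | mul a b ha hb =>
      have : (1 : MvPolynomial (Fin n) k) ⊗ₜ[k] (a * b) = (1 ⊗ₜ[k] a) * (1 ⊗ₜ[k] b) := by simp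
      rw [this]
      exact hmul _ _ (ha (by simp [PE])) (hb (by simp [PE]))
    | add a b ha hb =>
      rw [TensorProduct.tmul_add]
      exact hadd _ _ (ha (by simp [PE])) (hb (by simp [PE]))

def sw (k : Type) [Field k] (n r : ℕ) (hr : r + 1 < n) :
    MvPolynomial (Fin n) k →ₐ[k] MvPolynomial (Fin n) k :=
  rename (⇑(Equiv.swap (fr n r hr) (fr1 n r hr)))

theorem X_sub_ne (k : Type) [Field k] (n : ℕ) (i j : Fin n) (h : i ≠ j) :
    (X i - X j : MvPolynomial (Fin n) k) ≠ 0 := by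
  rw [sub_ne_zero]
  exact fun e => h (MvPolynomial.X_injective e)

theorem sw_X (k : Type) [Field k] (n r : ℕ) (hr : r + 1 < n) (j : ℕ) (hj : j < n) :
    sw k n r hr (X ⟨j, hj⟩) = X (if j = r then ⟨r + 1, hr⟩ else if j = r + 1 then
      ⟨r, Nat.lt_of_succ_lt hr⟩ else ⟨j, hj⟩) := by
  simp only [sw, rename_X, Equiv.swap_apply_def, fr, fr1, Fin.mk.injEq]

theorem sw_sw (k : Type) [Field k] (n r : ℕ) (hr : r + 1 < n) (Q : MvPolynomial (Fin n) k) :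
    sw k n r hr (sw k n r hr Q) = Q := by
  rw [sw, rename_rename]
  have : (⇑(Equiv.swap (fr n r hr) (fr1 n r hr)) ∘ ⇑(Equiv.swap (fr n r hr) (fr1 n r hr))) = id := by
    ext j; simp
  rw [this, rename_id_apply]

theorem sw_comm (k : Type) [Field k] (n r s : ℕ) (hr : r + 1 < n) (hs : s + 1 < n)
    (h : r + 1 < s ∨ s + 1 < r) (Q : MvPolynomial (Fin n) k) :
    sw k n r hr (sw k n s hs Q) = sw k n s hs (sw k n r hr Q) := by
  rw [← AlgHom.comp_apply, ← AlgHom.comp_apply]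
  congr 1
  ext1 ⟨j, hj⟩
  simp only [AlgHom.comp_apply, sw_X]
  split_ifs <;> simp only [sw_X] <;> congr 1 <;> grind

theorem sw_braid (k : Type) [Field k] (n r : ℕ) (hr : r + 1 < n) (hs : r + 1 + 1 < n)
    (Q : MvPolynomial (Fin n) k) :
    sw k n r hr (sw k n (r+1) hs (sw k n r hr Q)) =
      sw k n (r+1) hs (sw k n r hr (sw k n (r+1) hs Q)) := by
  have hn1 : ¬ (r = r + 1 + 1) := by omega
  have hn2 : ¬ (r + 1 + 1 = r) := by omega
  simp only [← AlgHom.comp_apply]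
  congr 1
  ext1 ⟨j, hj⟩
  by_cases h0 : j = r
  · subst h0; simp [sw_X, hn1, hn2]
  by_cases h1 : j = r + 1
  · subst h1; simp [sw_X, hn1, hn2]
  by_cases h2 : j = r + 1 + 1
  · subst h2; simp [sw_X, hn1, hn2]
  simp [sw_X, h0, h1, h2]

theorem P_inv (k : Type) [Field k] (n N : ℕ) (hn : 0 < n)
    (P : ℕ → MvPolynomial (Fin n) k)
    (hP0 : P 0 = X (⟨0, hn⟩ : Fin n) ^ N)
    (hPrec : ∀ (r : ℕ) (hr : r + 1 < n),
      (X (fr n r hr) - X (fr1 n r hr)) * P (r + 1) = -(P r - sw k n r hr (P r)))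
    (i : ℕ) : ∀ (_ : i < n) (r : ℕ) (hr : r + 1 < n), r ≠ i → sw k n r hr (P i) = P i := by
  induction i using Nat.strong_induction_on with
  | _ i ih =>
  intro hi r hr hne
  rcases i with _ | i
  · rw [hP0, map_pow, sw_X, if_neg (by omega), if_neg (by omega)]
  have key := hPrec i hi
  have key' := congrArg (sw k n r hr) key
  have hX : (X (fr n i hi) - X (fr1 n i hi) : MvPolynomial (Fin n) k) ≠ 0 :=
    X_sub_ne _ _ _ _ (by simp [fr, fr1])
  simp only [map_mul, map_sub, map_neg] at key'
  by_cases h1 : r = i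
  · subst h1
    rw [sw_sw] at key'
    simp only [fr, fr1, sw_X] at key' key hX
    simp at key'
    refine mul_left_cancel₀ hX ?_
    linear_combination -key' - key
  by_cases h2 : r + 1 = i
  · subst h2
    have hi' : r + 1 + 1 < n := hi
    have k0 := hPrec r hr
    have inv := ih r (by omega) (by omega) (r+1) hi (by omega)
    have k1 := congrArg (sw k n (r+1) hi) k0
    have br := sw_braid k n r hr hi (P r)
    rw [inv] at br
    simp only [map_mul, map_sub, map_neg, inv] at k1
    simp only [fr, fr1, sw_X] at k0 k1 key hX
    simp [show ¬ (r = r + 1 + 1) by omega] at k1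
    generalize hT : sw k n (r+1) hi (sw k n r hr (P r)) = T at *
    generalize hS : sw k n r hr (P r) = S at *
    generalize hU : sw k n (r+1) hi (P (r+1)) = U at *
    have hSS : sw k n r hr S = P r := by rw [← hS, sw_sw]
    have e : (X ⟨r, by omega⟩ - X ⟨r+1, hr⟩) * (X ⟨r, by omega⟩ - X ⟨r+1+1, hi⟩) *
        (X ⟨r+1, hr⟩ - X ⟨r+1+1, hi⟩) * P (r+1+1)
        = (X ⟨r, by omega⟩ - X ⟨r+1, hr⟩) * T - (X ⟨r, by omega⟩ - X ⟨r+1+1, hi⟩) * S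
          + (X ⟨r+1, hr⟩ - X ⟨r+1+1, hi⟩) * P r := by
      linear_combination (X ⟨r, by omega⟩ - X ⟨r+1, hr⟩) * (X ⟨r, by omega⟩ - X ⟨r+1+1, hi⟩) * key
        + (X ⟨r, by omega⟩ - X ⟨r+1, hr⟩) * k1 - (X ⟨r, by omega⟩ - X ⟨r+1+1, hi⟩) * k0
    have e' := congrArg (sw k n r hr) e
    simp only [map_mul, map_sub, map_add, sw_X, hSS, br, hS] at e'
    simp [show ¬ (r + 1 + 1 = r) by omega] at e'
    have hA := X_sub_ne k n ⟨r, by omega⟩ ⟨r+1, hr⟩ (by simp)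
    have hB := X_sub_ne k n ⟨r, by omega⟩ ⟨r+1+1, hi⟩ (by simp; omega)
    refine mul_left_cancel₀ (mul_ne_zero (mul_ne_zero hA hB) hX) ?_
    linear_combination -e' - e
  · have inv := ih i (by omega) (by omega) r hr h1
    rw [sw_comm k n r i hr hi (by omega), inv] at key'
    simp only [fr, fr1, sw_X] at key' key hX
    rw [if_neg (by omega), if_neg (by omega), if_neg (by omega), if_neg (by omega)] at key'
    exact mul_left_cancel₀ hX (key'.trans key.symm)

/-- Fix `N ≥ 0`. With `P_1 = X_1^N`, `P_{r+1} = -∂_r(P_r)` and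
`d_N = Σ_{i=1}^n P_i ω_i^-` (an operator on `EPol_n`), the operator `d_N` commutes with
every extended Demazure operator `∂_r` and every multiplication operator `X_i`, and
satisfies `d_N ∘ d_N = 0`. -/
theorem stmt_10 (k : Type) [Field k] (n N : ℕ) (hn : 0 < n)
    (σ : ∀ r : ℕ, r + 1 < n → (EPol k n →ₐ[k] EPol k n))
    (hσX : ∀ (r : ℕ) (hr : r + 1 < n) (i : Fin n),
      σ r hr (XE k n i) = XE k n (Equiv.swap (fr n r hr) (fr1 n r hr) i))
    (hσω : ∀ (r : ℕ) (hr : r + 1 < n) (i : Fin n),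
      i ≠ fr n r hr → σ r hr (wE k n i) = wE k n i)
    (hσωr : ∀ (r : ℕ) (hr : r + 1 < n),
      σ r hr (wE k n (fr n r hr)) =
        wE k n (fr n r hr) + (XE k n (fr n r hr) - XE k n (fr1 n r hr)) * wE k n (fr1 n r hr))
    (D : ∀ r : ℕ, r + 1 < n → (EPol k n →ₗ[k] EPol k n))
    (hD : ∀ (r : ℕ) (hr : r + 1 < n) (x : EPol k n),
      (XE k n (fr n r hr) - XE k n (fr1 n r hr)) * D r hr x = x - σ r hr x)
    (ε : EPol k n →ₐ[k] EPol k n)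
    (hεP : ∀ P : MvPolynomial (Fin n) k, ε (PE k n P) = PE k n P)
    (hεω : ∀ i : Fin n, ε (wE k n i) = - wE k n i)
    (A : Fin n → (EPol k n →ₗ[k] EPol k n))
    (hAder : ∀ (i : Fin n) (x y : EPol k n), A i (x * y) = A i x * y + ε x * A i y)
    (hAP : ∀ (i : Fin n) (P : MvPolynomial (Fin n) k), A i (PE k n P) = 0)
    (hAω : ∀ i j : Fin n, A i (wE k n j) = if i = j then 1 else 0)
    (P : ℕ → MvPolynomial (Fin n) k)
    (hP0 : P 0 = X (⟨0, hn⟩ : Fin n) ^ N)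
    (hPrec : ∀ (r : ℕ) (hr : r + 1 < n),
      (X (fr n r hr) - X (fr1 n r hr)) * P (r + 1) =
        -(P r - rename (⇑(Equiv.swap (fr n r hr) (fr1 n r hr))) (P r))) :
    (∀ (r : ℕ) (hr : r + 1 < n) (x : EPol k n),
      D r hr (∑ i : Fin n, PE k n (P i.1) * A i x) =
        ∑ i : Fin n, PE k n (P i.1) * A i (D r hr x)) ∧
    (∀ (j : Fin n) (x : EPol k n),
      (∑ i : Fin n, PE k n (P i.1) * A i (XE k n j * x)) =
        XE k n j * ∑ i : Fin n, PE k n (P i.1) * A i x) ∧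
    (∀ x : EPol k n,
      (∑ i : Fin n, PE k n (P i.1) * A i (∑ j : Fin n, PE k n (P j.1) * A j x)) = 0) := by
  have hinv := P_inv k n N hn P hP0 hPrec
  have hσP : ∀ (r : ℕ) (hr : r + 1 < n) (Q : MvPolynomial (Fin n) k),
      σ r hr (PE k n Q) = PE k n (sw k n r hr Q) := by
    intro r hr Q
    have : (σ r hr).comp (Algebra.TensorProduct.includeLeft :
          MvPolynomial (Fin n) k →ₐ[k] EPol k n)
        = (Algebra.TensorProduct.includeLeft :
          MvPolynomial (Fin n) k →ₐ[k] EPol k n).comp (sw k n r hr) := by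
      ext1 i
      have := hσX r hr i
      simpa [XE, sw] using this
    exact DFunLike.congr_fun this Q
  obtain ⟨d, hd⟩ : ∃ d : EPol k n →ₗ[k] EPol k n,
      ∀ x, d x = ∑ i : Fin n, PE k n (P i.1) * A i x :=
    ⟨∑ i : Fin n, (LinearMap.mulLeft k (PE k n (P i.1))) ∘ₗ A i, fun x => by
      simp [LinearMap.sum_apply]⟩
  simp only [← hd]
  have hder : ∀ x y, d (x * y) = d x * y + ε x * d y := by
    intro x y
    simp only [hd, hAder, mul_add, Finset.sum_add_distrib, Finset.sum_mul, Finset.mul_sum]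
    congr 1
    · simp only [mul_assoc]
    · refine Finset.sum_congr rfl fun i _ => ?_
      rw [← mul_assoc, PE_comm, mul_assoc]
  have hdP : ∀ Q, d (PE k n Q) = 0 := fun Q => by simp [hd, hAP]
  have hdw : ∀ i, d (wE k n i) = PE k n (P i.1) := fun i => by simp [hd, hAω]
  have hdPm : ∀ Q x, d (PE k n Q * x) = PE k n Q * d x := fun Q x => by
    rw [hder, hdP, hεP, zero_mul, zero_add]
  clear hd hAder hAP hAω
  have hεε : ∀ x, ε (ε x) = x := by
    intro x
    induction x using EPol_ind with
    | hP Q => simp [hεP]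
    | hw i => simp [hεω]
    | hadd x y hx hy => simp [hx, hy]
    | hmul x y hx hy => simp [hx, hy]
  have hdε : ∀ x, d (ε x) = - ε (d x) := by
    intro x
    induction x using EPol_ind with
    | hP Q => simp [hεP, hdP]
    | hw i => simp [hεω, hdw, hεP]
    | hadd x y hx hy => rw [map_add, map_add, hx, hy, map_add, map_add, neg_add]
    | hmul x y hx hy =>
      rw [map_mul, hder, hder, map_add, map_mul, map_mul, hx, hy]
      rw [E_neg_mul, E_mul_neg, neg_add]
  have hσε : ∀ r hr x, σ r hr (ε x) = ε (σ r hr x) := by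
    intro r hr x
    induction x using EPol_ind with
    | hP Q => simp only [hσP, hεP]
    | hw i =>
      by_cases h : i = fr n r hr
      · subst h
        simp only [hεω, hσωr, map_neg, map_add, map_mul, map_sub, PE_X, hεP]
        rw [E_mul_neg, neg_add]
      · simp only [hεω, hσω r hr i h, map_neg]
    | hadd x y hx hy => simp only [map_add, hx, hy]
    | hmul x y hx hy => simp only [map_mul, hx, hy]
  have hσd : ∀ r hr x, σ r hr (d x) = d (σ r hr x) := by
    intro r hr x
    induction x using EPol_ind with
    | hP Q => simp only [hσP, hdP, map_zero]
    | hw i =>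
      by_cases h : i = fr n r hr
      · subst h
        rw [hσωr, hdw, hσP, map_add, PE_X, PE_X, ← PE_sub, hdPm, hdw, hdw, ← PE_mul, ← PE_add]
        congr 1
        have := hPrec r hr
        change _ = P r + _ * P (r + 1)
        rw [this]
        change sw k n r hr (P r) = P r + -(P r - sw k n r hr (P r))
        ring
      · rw [hσω r hr i h, hdw, hσP, hinv i.1 i.2 r hr (fun e => h (by simp [fr, e]))]
    | hadd x y hx hy => simp only [map_add, hx, hy]
    | hmul x y hx hy => simp only [map_mul, hder, map_add, hx, hy, hσε]
  refine ⟨?_, ?_, ?_⟩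
  · intro r hr x
    apply PE_cancel k n (X (fr n r hr) - X (fr1 n r hr)) (X_sub_ne _ _ _ _ (by simp [fr, fr1]))
    rw [← hdPm, PE_sub, ← PE_X, ← PE_X, hD, hD, map_sub, hσd]
  · intro j x
    exact hdPm _ _
  · intro x
    induction x using EPol_ind with
    | hP Q => simp [hdP]
    | hw i => rw [hdw, hdP]
    | hadd x y hx hy => rw [map_add, map_add, hx, hy, add_zero]
    | hmul x y hx hy =>
      rw [hder, map_add, hder, hder, hx, hy, hdε, E_neg_mul]
      simp
end
end

section
/- The cyclotomic nil-Hecke algebra NH_n^N (quotient of the nil-Hecke algebra NH_n by the two-sided ideal generated by X_1^N) has dimension n!·N!/(N-n)! over k when n ≤ N; equivalently dim_k NH_n^N = (n!)² · C(N,n). -/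
open MvPolynomial

noncomputable instance shortcutRing (k : Type) [Field k] (n : ℕ)
    (S : Subalgebra k (Module.End k (MvPolynomial (Fin n) k))) : Ring ↥S :=
  inferInstance

noncomputable instance shortcutAlgebra (k : Type) [Field k] (n : ℕ)
    (S : Subalgebra k (Module.End k (MvPolynomial (Fin n) k))) : Algebra k ↥S :=
  inferInstance

set_option linter.unusedSectionVars false

namespace NilHecke

section Abstract

/-- Abstract counting lemma for the quotient. -/
theorem finrank_ringQuot {k S P : Type} [Field k] [Ring S] [Algebra k S] [CommRing P] [Algebra k P]
    (act : S →ₐ[k] Module.End k P) (hinj : Function.Injective act) (r : S → S → Prop)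
    (z : S) (hr : ∀ a b, r a b ↔ a = z ∧ b = 0) (J : Ideal P) [Module.Finite k (P ⧸ J)]
    {ι : Type} [Fintype ι] [DecidableEq ι] (u v : ι → P) (d : S) (mul : P →ₗ[k] S)
    (hmul : ∀ p q, act (mul p) q = p * q)
    (h1 : ∀ p, ∑ w, u w * act d (v w * p) = p)
    (h2 : ∀ w w', act d (v w * u w') = if w = w' then 1 else 0)
    (h3 : ∀ f p q, act f (act d p * q) = act d p * act f q)
    (h4 : ∀ f, ∀ q ∈ J, act f q ∈ J)
    (h5 : ∀ q, act z q ∈ J)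
    (h6 : ∀ q ∈ J, RingQuot.mkAlgHom k r (mul q * d) = 0) :
    Module.finrank k (RingQuot r) = Fintype.card ι * Module.finrank k (P ⧸ J) := by
  classical
  -- the evaluation map
  let Φ : S →ₗ[k] (ι → P ⧸ J) := LinearMap.pi fun w =>
    (Ideal.Quotient.mkₐ k J).toLinearMap ∘ₗ (LinearMap.applyₗ (u w)) ∘ₗ act.toLinearMap
  have hΦ : ∀ f w, Φ f w = Ideal.Quotient.mk J (act f (u w)) := fun f w => rfl
  have hsurj : Function.Surjective Φ := by
    intro q
    choose q' hq' using fun w => Ideal.Quotient.mk_surjective (q w)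
    refine ⟨∑ w, mul (q' w) * d * mul (v w), ?_⟩
    funext w'
    rw [hΦ, ← hq']
    congr 1
    simp [hmul, h2]
  have hexp : ∀ f, f = ∑ w, mul (act f (u w)) * d * mul (v w) := by
    intro f
    apply hinj
    ext p
    conv_lhs => rw [← h1 p]
    rw [map_sum, map_sum]
    simp only [map_mul, Module.End.mul_apply, LinearMap.sum_apply, hmul]
    refine Finset.sum_congr rfl fun w _ => ?_
    rw [mul_comm, h3, mul_comm]
  let mk := RingQuot.mkAlgHom k r
  -- action on the quotient
  let Js : Submodule k P := J.restrictScalars k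
  have hJs : ∀ f, Js ≤ Js.comap (act f) := fun f q hq => h4 f q hq
  let ρ : S →ₐ[k] Module.End k (P ⧸ Js) := AlgHom.ofLinearMap
    { toFun := fun f => Js.mapQ Js (act f) (hJs f)
      map_add' := fun f g => by
        ext p; simp
      map_smul' := fun c f => by
        ext p; simp }
    (by ext p; simp)
    (fun f g => by ext p; simp)
  have hρ : ∀ f p, ρ f (Submodule.Quotient.mk p) = Submodule.Quotient.mk (act f p) := fun f p => rfl
  have hker : LinearMap.ker mk.toLinearMap = LinearMap.ker Φ := by
    apply le_antisymm
    · intro f hf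
      have hf' : mk f = 0 := hf
      let lift := RingQuot.liftAlgHom k (s := r) ⟨ρ, by
        intro a b hab
        obtain ⟨rfl, rfl⟩ := (hr a b).1 hab
        rw [map_zero]
        apply LinearMap.ext
        intro p
        obtain ⟨p, rfl⟩ := Submodule.Quotient.mk_surjective _ p
        rw [hρ]
        exact (Submodule.Quotient.mk_eq_zero _).2 (h5 p)⟩
      have h0 : ρ f = 0 := by
        have : lift (mk f) = ρ f := RingQuot.liftAlgHom_mkAlgHom_apply k ρ _ f
        rw [← this, hf', map_zero]
      rw [LinearMap.mem_ker]
      funext w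
      rw [hΦ]
      apply Ideal.Quotient.eq_zero_iff_mem.2
      have := hρ f (u w)
      rw [h0] at this
      exact (Submodule.Quotient.mk_eq_zero Js).1 this.symm
    · intro f hf
      have hf' : ∀ w, act f (u w) ∈ J := by
        intro w
        apply Ideal.Quotient.eq_zero_iff_mem.1
        rw [← hΦ, LinearMap.mem_ker.1 hf]; rfl
      change mk f = 0
      rw [hexp f, map_sum]
      apply Finset.sum_eq_zero
      intro w _
      rw [map_mul, h6 _ (hf' w), zero_mul]
  have e1 := mk.toLinearMap.quotKerEquivOfSurjective (RingQuot.mkAlgHom_surjective k r)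
  have e2 := Φ.quotKerEquivOfSurjective hsurj
  rw [hker] at e1
  rw [(e1.symm.trans e2).finrank_eq, Module.finrank_pi_fintype]
  simp

end Abstract
end NilHecke

namespace NilHecke

section Series
variable {P : Type} [CommRing P]

/-- geometric series `1/(1 - y t)` -/
noncomputable def G (y : P) : PowerSeries P := PowerSeries.mk fun m => y ^ m

/-- `1 - y t` -/
noncomputable def L (y : P) : PowerSeries P := 1 - PowerSeries.C y * PowerSeries.X

theorem G_mul_L (y : P) : G y * L y = 1 := by
  ext m
  rw [L, mul_sub, mul_one, ← mul_assoc, map_sub]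
  cases m with
  | zero => simp [G]
  | succ m =>
    rw [PowerSeries.coeff_succ_mul_X, PowerSeries.coeff_mul_C]
    simp [G, pow_succ, PowerSeries.coeff_one]

theorem G_sub (y z : P) : G y - G z = PowerSeries.C (y - z) * (PowerSeries.X * (G y * G z)) := by
  have h1 := G_mul_L y
  have h2 := G_mul_L z
  have : G y - G z = G y * G z * (L z - L y) := by
    linear_combination G y * h2 * (-1) + G z * h1
  rw [this, L, L, map_sub]; ring

/-- generating series of complete symmetric functions -/
noncomputable def HS (x : ℕ → P) (S : Finset ℕ) : PowerSeries P := ∏ i ∈ S, G (x i)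
noncomputable def ES (x : ℕ → P) (S : Finset ℕ) : PowerSeries P := ∏ i ∈ S, L (x i)

theorem HS_mul_ES (x : ℕ → P) (S : Finset ℕ) : HS x S * ES x S = 1 := by
  rw [HS, ES, ← Finset.prod_mul_distrib]
  exact Finset.prod_eq_one fun i _ => G_mul_L _

theorem ES_coeff_zero_of_lt (x : ℕ → P) (S : Finset ℕ) :
    ∀ m, S.card < m → PowerSeries.coeff m (ES x S) = 0 := by
  classical
  induction S using Finset.induction_on with
  | empty => intro m hm; simp [ES, PowerSeries.coeff_one] at *; omega
  | insert a S ha ih =>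
    intro m hm
    rw [Finset.card_insert_of_notMem ha] at hm
    obtain ⟨m, rfl⟩ : ∃ m', m = m' + 1 := ⟨m - 1, by omega⟩
    have : ES x (insert a S) = ES x S - PowerSeries.C (x a) * (ES x S * PowerSeries.X) := by
      rw [ES, Finset.prod_insert ha, L, ES]; ring
    rw [this, map_sub, PowerSeries.coeff_C_mul, PowerSeries.coeff_succ_mul_X, ih _ (by omega),
      ih _ (by omega)]
    simp

theorem map_G {Q : Type} [CommRing Q] (f : P →+* Q) (y : P) : PowerSeries.map f (G y) = G (f y) := by
  ext m; simp [G]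
theorem map_L {Q : Type} [CommRing Q] (f : P →+* Q) (y : P) : PowerSeries.map f (L y) = L (f y) := by
  simp [L]

end Series

/-- The nil-Hecke data. -/
structure NHD {k P : Type} [Field k] [CommRing P] [Algebra k P] (n : ℕ) (x : ℕ → P)
    (s : ℕ → P →ₐ[k] P) (D : ℕ → Module.End k P) : Prop where
  hD : ∀ r, r + 1 < n → ∀ p, (x (r + 1) - x r) * D r p = p - s r p
  hs : ∀ r, r + 1 < n → ∀ i, s r (x i) = x (Equiv.swap r (r + 1) i)
  hne : ∀ i j, i < j → j < n → x j - x i ≠ 0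
  hss : ∀ r, r + 1 < n → ∀ p, s r (s r p) = p
  hfar : ∀ r t, r + 1 < t → t + 1 < n → ∀ p, s r (s t p) = s t (s r p)
  hbraid : ∀ r, r + 2 < n → ∀ p, s r (s (r + 1) (s r p)) = s (r + 1) (s r (s (r + 1) p))

namespace NHD

variable {k P : Type} [Field k] [CommRing P] [IsDomain P] [Algebra k P] {n : ℕ} {x : ℕ → P}
  {s : ℕ → P →ₐ[k] P} {D : ℕ → Module.End k P} (H : NHD n x s D)
include H

theorem sl {r} (hr : r + 1 < n) : s r (x r) = x (r + 1) := by rw [H.hs r hr]; simp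
theorem sr {r} (hr : r + 1 < n) : s r (x (r + 1)) = x r := by rw [H.hs r hr]; simp
theorem si {r i} (hr : r + 1 < n) (h1 : i ≠ r) (h2 : i ≠ r + 1) : s r (x i) = x i := by
  rw [H.hs r hr, Equiv.swap_apply_of_ne_of_ne h1 h2]

theorem cancel {r} (hr : r + 1 < n) {p q : P} (h : (x (r + 1) - x r) * p = (x (r + 1) - x r) * q) :
    p = q := mul_left_cancel₀ (H.hne r (r + 1) (by omega) hr) h

theorem leib {r} (hr : r + 1 < n) (p q : P) : D r (p * q) = D r p * q + s r p * D r q := by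
  apply H.cancel hr
  have h1 := H.hD r hr (p * q)
  have h2 := H.hD r hr p
  have h3 := H.hD r hr q
  rw [map_mul (s r)] at h1
  linear_combination h1 - q * h2 - s r p * h3

theorem D_zero_iff {r} (hr : r + 1 < n) (p : P) : D r p = 0 ↔ s r p = p := by
  have h := H.hD r hr p
  constructor
  · intro h0; rw [h0] at h; linear_combination h
  · intro h0; apply H.cancel hr; rw [h, h0]; ring

theorem s_D {r} (hr : r + 1 < n) (p : P) : s r (D r p) = D r p := by
  apply H.cancel hr
  have h := H.hD r hr p
  have h' := congrArg (s r) h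
  rw [map_mul, map_sub, map_sub, H.hss r hr, H.sl hr, H.sr hr] at h'
  linear_combination -h - h'

theorem D_D {r} (hr : r + 1 < n) (p : P) : D r (D r p) = 0 := (H.D_zero_iff hr _).2 (H.s_D hr p)

theorem D_lin {r} (hr : r + 1 < n) {c : P} (hc : D r c = 0) (p : P) : D r (c * p) = c * D r p := by
  rw [H.leib hr, hc, (H.D_zero_iff hr c).1 hc]; ring

theorem s_far_D {r t} (hr : r + 1 < n) (ht : t + 1 < n) (h : r + 1 < t ∨ t + 1 < r) (p : P) :
    s r (D t p) = D t (s r p) := by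
  apply H.cancel ht
  have h1 := congrArg (s r) (H.hD t ht p)
  have h2 := H.hD t ht (s r p)
  rw [map_mul, map_sub, map_sub, H.si hr (by omega) (by omega), H.si hr (by omega) (by omega)] at h1
  have : s r (s t p) = s t (s r p) := by
    rcases h with h | h
    · exact H.hfar r t h ht p
    · exact (H.hfar t r h hr p).symm
  linear_combination h1 - h2 - this

theorem far {r t} (hr : r + 1 < n) (ht : t + 1 < n) (h : r + 1 < t ∨ t + 1 < r) (p : P) :
    D r (D t p) = D t (D r p) := by
  apply H.cancel hr
  apply H.cancel ht
  have h1 := H.hD r hr (D t p)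
  have h2 := H.hD t ht (D r p)
  have h3 := H.hD t ht p
  have h4 := H.hD r hr p
  have e1 := H.s_far_D hr ht h p
  have e2 := H.s_far_D ht hr h.symm p
  have h5 := H.hD t ht (s r p)
  have h6 := H.hD r hr (s t p)
  have e3 : s r (s t p) = s t (s r p) := by
    rcases h with h | h
    · exact H.hfar r t h ht p
    · exact (H.hfar t r h hr p).symm
  rw [e1] at h1
  rw [e2] at h2
  linear_combination (x (t+1) - x t) * h1 - (x (r+1) - x r) * h2 + h3 - h4 - h5 + h6 - e3

/-- Fully expanded braid word. -/
theorem braid {r} (hr : r + 2 < n) (p : P) :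
    D r (D (r + 1) (D r p)) = D (r + 1) (D r (D (r + 1) p)) := by
  have hr0 : r + 1 < n := by omega
  have hr1 : r + 1 + 1 < n := by omega
  have b1 : s r (x (r + 1 + 1)) = x (r + 1 + 1) := H.si hr0 (by omega) (by omega)
  have b2 : s (r + 1) (x r) = x r := H.si hr1 (by omega) (by omega)
  have a1 := H.sl hr0
  have a2 := H.sr hr0
  have a3 := H.sl hr1
  have a4 := H.sr hr1
  have hne := H.hne r (r + 1 + 1) (by omega) (by omega)
  set a := x r with ha
  set b := x (r + 1) with hb
  set c := x (r + 1 + 1) with hc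
  have d0 : ∀ p, (b - a) * D r p = p - s r p := H.hD r hr0
  have d1 : ∀ p, (c - b) * D (r + 1) p = p - s (r + 1) p := H.hD (r + 1) hr1
  -- consequences
  have e1 : ∀ p, (c - a) * s (r + 1) (D r p) = s (r + 1) p - s (r + 1) (s r p) := fun p => by
    have := congrArg (s (r + 1)) (d0 p)
    simpa [a3, b2, map_mul, map_sub] using this
  have e0 : ∀ p, (c - a) * s r (D (r + 1) p) = s r p - s r (s (r + 1) p) := fun p => by
    have := congrArg (s r) (d1 p)
    simpa [a2, b1, map_mul, map_sub] using this
  have f0 : ∀ p, (c - b) * s r (s (r + 1) (D r p)) = s r (s (r + 1) p) - s r (s (r + 1) (s r p)) :=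
    fun p => by
      have := congrArg (s r) (e1 p)
      simpa [a1, b1, map_mul, map_sub] using this
  have f1 : ∀ p, (b - a) * s (r + 1) (s r (D (r + 1) p))
      = s (r + 1) (s r p) - s (r + 1) (s r (s (r + 1) p)) :=
    fun p => by
      have := congrArg (s (r + 1)) (e0 p)
      simpa [a4, b2, map_mul, map_sub] using this
  have g0 := H.s_D hr0 p
  have g1 := H.s_D hr1 p
  have bb := H.hbraid r hr p
  apply H.cancel hr0
  apply H.cancel hr1
  apply mul_left_cancel₀ hne
  rw [← ha, ← hb, ← hc]
  have t0 := d0 (D (r + 1) (D r p))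
  have t1 := d1 (D r (D (r + 1) p))
  have u0 := d1 (D r p)
  have u1 := d0 (D (r + 1) p)
  have v0 := e0 (D r p)
  have v1 := e1 (D (r + 1) p)
  rw [g0] at v0
  rw [g1] at v1
  have z0 := d0 p
  have z1 := d1 p
  have y0 := e1 p
  have y1 := e0 p
  have q0 := f0 p
  have q1 := f1 p
  linear_combination (c - b) * (c - a) * t0 + (c - a) * u0 - (c - b) * v0 + z0 - y0 + q0
    - ((b - a) * (c - a) * t1 + (c - a) * u1 - (b - a) * v1 + z1 - y1 + q1) - bb

end NHD

namespace NHD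

variable {k P : Type} [Field k] [CommRing P] [IsDomain P] [Algebra k P] {n : ℕ} {x : ℕ → P}
  {s : ℕ → P →ₐ[k] P} {D : ℕ → Module.End k P} (H : NHD n x s D)
include H

/-- Symmetric products are fixed. -/
theorem prod_fixed {r} (hr : r + 1 < n) (F : P → PowerSeries P)
    (hF : ∀ y, PowerSeries.map (s r : P →+* P) (F y) = F (s r y)) (S : Finset ℕ)
    (hS : r ∈ S ↔ r + 1 ∈ S) :
    PowerSeries.map (s r : P →+* P) (∏ i ∈ S, F (x i)) = ∏ i ∈ S, F (x i) := by
  rw [map_prod]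
  refine Finset.prod_equiv (Equiv.swap r (r + 1)) ?_ ?_
  · intro i
    rcases eq_or_ne i r with rfl | h1
    · simpa using hS
    rcases eq_or_ne i (r + 1) with rfl | h2
    · simpa using hS.symm
    rw [Equiv.swap_apply_of_ne_of_ne h1 h2]
  · intro i _
    rw [hF, H.hs r hr]

theorem D_coeff_zero {r} (hr : r + 1 < n) {F : PowerSeries P}
    (hF : PowerSeries.map (s r : P →+* P) F = F) (m : ℕ) : D r (PowerSeries.coeff m F) = 0 := by
  rw [H.D_zero_iff hr]
  conv_rhs => rw [← hF, PowerSeries.coeff_map]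
  rfl

theorem HS_fixed {r} (hr : r + 1 < n) (S : Finset ℕ) (hS : r ∈ S ↔ r + 1 ∈ S) :
    PowerSeries.map (s r : P →+* P) (HS x S) = HS x S :=
  H.prod_fixed hr G (fun y => map_G _ y) S hS

theorem ES_fixed {r} (hr : r + 1 < n) (S : Finset ℕ) (hS : r ∈ S ↔ r + 1 ∈ S) :
    PowerSeries.map (s r : P →+* P) (ES x S) = ES x S :=
  H.prod_fixed hr L (fun y => map_L _ y) S hS

theorem D_HS_right {r} (hr : r + 1 < n) (S : Finset ℕ) (h0 : r ∉ S) (h1 : r + 1 ∉ S) (d m : ℕ) :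
    D r (PowerSeries.coeff m (PowerSeries.X ^ d * HS x (insert (r + 1) S))) =
      PowerSeries.coeff m (PowerSeries.X ^ (d + 1) * HS x (insert r (insert (r + 1) S))) := by
  apply H.cancel hr
  rw [H.hD r hr]
  have hfix := H.HS_fixed hr S (by tauto)
  have e1 : HS x (insert (r + 1) S) = G (x (r + 1)) * HS x S := Finset.prod_insert h1
  have e2 : HS x (insert r (insert (r + 1) S)) = G (x r) * (G (x (r + 1)) * HS x S) := by
    rw [HS, Finset.prod_insert (by simp [h0]), Finset.prod_insert h1]; rfl
  have e3 : s r (PowerSeries.coeff m (PowerSeries.X ^ d * HS x (insert (r + 1) S))) =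
      PowerSeries.coeff m (PowerSeries.X ^ d * (G (x r) * HS x S)) := by
    have : PowerSeries.map (s r : P →+* P) (PowerSeries.X ^ d * HS x (insert (r + 1) S)) =
        PowerSeries.X ^ d * (G (x r) * HS x S) := by
      rw [e1, map_mul, map_mul, map_pow, PowerSeries.map_X, hfix, map_G]
      congr 3
      exact H.sr hr
    rw [← this, PowerSeries.coeff_map]; rfl
  rw [e3, e2, e1, ← map_sub, ← PowerSeries.coeff_C_mul]
  congr 1
  have := G_sub (x (r + 1)) (x r)
  rw [pow_succ]
  linear_combination PowerSeries.X ^ d * HS x S * this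

theorem D_HS_left {r} (hr : r + 1 < n) (S : Finset ℕ) (h0 : r ∉ S) (h1 : r + 1 ∉ S) (m : ℕ) :
    D r (PowerSeries.coeff (m + 1) (HS x (insert r S))) =
      - PowerSeries.coeff m (HS x (insert r (insert (r + 1) S))) := by
  apply H.cancel hr
  rw [H.hD r hr]
  have hfix := H.HS_fixed hr S (by tauto)
  have e1 : HS x (insert r S) = G (x r) * HS x S := Finset.prod_insert h0
  have e2 : HS x (insert r (insert (r + 1) S)) = G (x r) * (G (x (r + 1)) * HS x S) := by
    rw [HS, Finset.prod_insert (by simp [h0]), Finset.prod_insert h1]; rfl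
  have e3 : s r (PowerSeries.coeff (m + 1) (HS x (insert r S))) =
      PowerSeries.coeff (m + 1) (G (x (r + 1)) * HS x S) := by
    have : PowerSeries.map (s r : P →+* P) (HS x (insert r S)) =
        (G (x (r + 1)) * HS x S) := by
      rw [e1, map_mul, hfix, map_G]
      congr 2
      exact H.sl hr
    rw [← this, PowerSeries.coeff_map]; rfl
  have e4 : G (x r) * HS x S - G (x (r + 1)) * HS x S =
      -(PowerSeries.C (x (r + 1) - x r) * (G (x r) * (G (x (r + 1)) * HS x S))) * PowerSeries.X := by
    have := G_sub (x (r + 1)) (x r)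
    linear_combination - HS x S * this
  rw [e3, e2, e1, ← map_sub, e4, PowerSeries.coeff_succ_mul_X, map_neg, PowerSeries.coeff_C_mul, mul_neg]

/-- `D_i D_{i+1} ... D_{i+d-1}` -/
def E (D : ℕ → Module.End k P) : ℕ → ℕ → Module.End k P
  | _, 0 => 1
  | i, d + 1 => D i * E D (i + 1) d

omit H in
theorem E_zero (i : ℕ) : E D i 0 = 1 := rfl
omit H in
theorem E_succ (i d : ℕ) (p : P) : E D i (d + 1) p = D i (E D (i + 1) d p) := rfl

theorem D_far_E {r i} (hr : r + 1 < i) : ∀ d, i + d < n → ∀ p, D r (E D i d p) = E D i d (D r p) := by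
  intro d
  induction d generalizing i with
  | zero => intro _ p; rfl
  | succ d ih =>
    intro h p
    rw [E_succ, E_succ, H.far (by omega) (by omega) (by omega), ih (by omega) (by omega)]

theorem E_lin {c : P} : ∀ d i, i + d < n → (∀ r, i ≤ r → r < i + d → D r c = 0) → ∀ p,
    E D i d (c * p) = c * E D i d p := by
  intro d
  induction d with
  | zero => intro i _ _ p; rfl
  | succ d ih =>
    intro i h hc p
    rw [E_succ, E_succ, ih (i + 1) (by omega) (fun r h1 h2 => hc r (by omega) (by omega)),
      H.D_lin (by omega) (hc i (by omega) (by omega))]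

/-- `E 0 j` lands in symmetric elements. -/
theorem D_E_zero (j : ℕ) (p : P) : ∀ d i r, i + d = j → j < n → i ≤ r → r < j →
    (∀ r, r + 1 < j → D r p = 0) → D r (E D i d p) = 0 := by
  intro d
  induction d with
  | zero => intro i r h _ h1 h2; omega
  | succ d ih =>
    intro i r h hj h1 h2 hp
    rcases eq_or_lt_of_le h1 with rfl | h1
    · rw [E_succ, H.D_D (by omega)]
    rcases eq_or_lt_of_le (Nat.succ_le_of_lt h1) with h3 | h3
    · obtain ⟨d, rfl⟩ : ∃ d', d = d' + 1 := ⟨d - 1, by omega⟩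
      subst h3
      rw [E_succ, E_succ]
      change D (i + 1) (D i (D (i + 1) _)) = 0
      rw [← H.braid (by omega), H.D_far_E (by omega) _ (by omega), hp i (by omega)]
      simp
    · change i + 1 < r at h3
      rw [E_succ, H.far (by omega) (by omega) (by omega),
        ih (i + 1) r (by omega) hj (by omega) h2 hp, map_zero]

theorem claim (m : ℕ) (p : P) : ∀ d i, i + d < n → (∀ r, r + 1 < i + d → D r p = 0) →
    E D i d (x (i + d) ^ m * p) = ∑ l ∈ Finset.range (d + 1),
      PowerSeries.coeff m (PowerSeries.X ^ l * HS x (Finset.Ico i (i + l + 1))) * E D (i + l) (d - l) p := by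
  intro d
  induction d with
  | zero => intro i _ _; simp [E_zero, HS, G]
  | succ d ih =>
    intro i h hp
    have hi := ih (i + 1) (by omega) (fun r hr => hp r (by omega))
    have e : i + (d + 1) = i + 1 + d := by ring
    rw [E_succ, e, hi, map_sum, Finset.sum_range_succ' _ (d + 1)]
    simp only [H.leib (show i + 1 < n by omega)]
    rw [Finset.sum_add_distrib]
    congr 1
    · refine Finset.sum_congr rfl fun l hl => ?_
      have e1 : Finset.Ico (i + 1) (i + 1 + l + 1) = insert (i + 1) (Finset.Ico (i + 2) (i + 1 + l + 1)) := by
        ext a; simp; omega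
      have e2 : Finset.Ico i (i + (l + 1) + 1)
          = insert i (insert (i + 1) (Finset.Ico (i + 2) (i + 1 + l + 1))) := by
        ext a; simp; omega
      rw [e1, H.D_HS_right (by omega) _ (by simp) (by simp), e2]
      have e3 : i + 1 + l = i + (l + 1) := by ring
      have e4 : d - l = d + 1 - (l + 1) := by omega
      rw [e3, e4]
    · rw [Finset.sum_range_succ']
      rw [Finset.sum_eq_zero]
      · simp only [zero_add, add_zero, Nat.sub_zero]
        rw [E_succ]
        congr 1
        simp [HS, G, H.sr (show i + 1 < n by omega)]
      · intro l hl
        rw [Finset.mem_range] at hl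
        rw [H.D_far_E (by omega) _ (by omega), hp i (by omega), map_zero, mul_zero]

/-- dual basis elements -/
theorem dual1 (j : ℕ) (hj : j < n) (p : P) (hp : ∀ r, r + 1 < j → D r p = 0) :
    ∑ a : Fin (j + 1), PowerSeries.coeff (j - a) (ES x (Finset.range j)) * E D 0 j (x j ^ (a : ℕ) * p) = p := by
  have hc := fun m => H.claim m p j 0 (by omega) (by simpa using hp)
  simp only [zero_add] at hc
  rw [Fin.sum_univ_eq_sum_range (fun a => PowerSeries.coeff (j - a) (ES x (Finset.range j)) * E D 0 j (x j ^ a * p))]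
  simp only [hc, Finset.mul_sum]
  rw [Finset.sum_comm]
  have key : ∀ l ∈ Finset.range (j + 1), ∑ a ∈ Finset.range (j + 1),
      PowerSeries.coeff (j - a) (ES x (Finset.range j)) *
        (PowerSeries.coeff a (PowerSeries.X ^ l * HS x (Finset.Ico 0 (l + 1))) * E D l (j - l) p) =
      (if l = j then 1 else 0) * E D l (j - l) p := by
    intro l hl
    rw [Finset.mem_range] at hl
    simp only [← mul_assoc]
    rw [← Finset.sum_mul]
    congr 1
    have : PowerSeries.coeff j (PowerSeries.X ^ l * HS x (Finset.Ico 0 (l + 1)) * ES x (Finset.range j))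
        = ∑ a ∈ Finset.range (j + 1), PowerSeries.coeff (j - a) (ES x (Finset.range j)) *
        PowerSeries.coeff a (PowerSeries.X ^ l * HS x (Finset.Ico 0 (l + 1))) := by
      rw [PowerSeries.coeff_mul, Finset.Nat.sum_antidiagonal_eq_sum_range_succ_mk]
      exact Finset.sum_congr rfl fun a _ => mul_comm _ _
    rw [← this]
    split_ifs with h
    · subst h
      rw [mul_assoc, PowerSeries.coeff_X_pow_mul', if_pos le_rfl, Nat.sub_self,
        PowerSeries.coeff_zero_eq_constantCoeff_apply, map_mul, HS, ES, map_prod, map_prod,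
        Finset.prod_eq_one, Finset.prod_eq_one, mul_one]
      · intro i _; simp [L]
      · intro i _
        rw [← PowerSeries.coeff_zero_eq_constantCoeff_apply]; simp [G]
    · have e : ES x (Finset.range j) = ES x (Finset.Ico 0 (l + 1)) * ES x (Finset.Ico (l + 1) j) := by
        rw [Finset.range_eq_Ico]
        exact (Finset.prod_Ico_consecutive (fun i => L (x i)) (by omega) (by omega)).symm
      have e' := HS_mul_ES x (Finset.Ico 0 (l + 1))
      have e'' : PowerSeries.X ^ l * HS x (Finset.Ico 0 (l + 1)) * ES x (Finset.range j) =
          PowerSeries.X ^ l * ES x (Finset.Ico (l + 1) j) := by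
        rw [e]; linear_combination PowerSeries.X ^ l * ES x (Finset.Ico (l + 1) j) * e'
      rw [e'', PowerSeries.coeff_X_pow_mul', if_pos (by omega)]
      apply ES_coeff_zero_of_lt
      simp; omega
  rw [Finset.sum_congr rfl key, Finset.sum_range_succ, Finset.sum_eq_zero]
  · simp [E_zero]
  · intro l hl
    rw [Finset.mem_range] at hl
    rw [if_neg (by omega), zero_mul]

theorem E_pow (j : ℕ) (hj : j < n) (m : ℕ) : E D 0 j (x j ^ m) =
    PowerSeries.coeff m (PowerSeries.X ^ j * HS x (Finset.range (j + 1))) := by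
  have h1 : ∀ r, r + 1 < n → D r 1 = 0 := fun r hr => by rw [H.D_zero_iff hr, map_one]
  have hc := H.claim m 1 j 0 (by omega) (fun r hr => h1 r (by omega))
  simp only [zero_add, mul_one] at hc
  rw [hc, Finset.sum_range_succ, Finset.sum_eq_zero]
  · simp [E_zero]
  · intro l hl
    rw [Finset.mem_range] at hl
    obtain ⟨d, hd⟩ : ∃ d, j - l = d + 1 := ⟨j - l - 1, by omega⟩
    have e1 : ∀ d i, i + d + 1 < n → E D i (d + 1) (1 : P) = 0 := by
      intro d
      induction d with
      | zero => intro i hi; rw [E_succ]; exact h1 i hi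
      | succ d ih => intro i hi; rw [E_succ, ih (i + 1) (by omega), map_zero]
    rw [hd, e1 d l (by omega), mul_zero]

theorem dual2 (j : ℕ) (hj : j < n) (a b : Fin (j + 1)) :
    E D 0 j (x j ^ (a : ℕ) * PowerSeries.coeff (j - b) (ES x (Finset.range j))) =
      if a = b then 1 else 0 := by
  have e : ES x (Finset.range j) = ES x (Finset.range (j + 1)) * G (x j) := by
    have := G_mul_L (x j)
    rw [ES, ES, Finset.prod_range_succ, mul_assoc, mul_comm (L _), this, mul_one]
  have hz : ∀ t r, r < j → D r (PowerSeries.coeff t (ES x (Finset.range (j + 1)))) = 0 := by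
    intro t r hr
    refine H.D_coeff_zero (by omega) (H.ES_fixed (by omega) _ ?_) t
    simp; omega
  have ha := a.2
  have hb := b.2
  rw [e, PowerSeries.coeff_mul, Finset.mul_sum, map_sum]
  have key : ∀ q ∈ Finset.HasAntidiagonal.antidiagonal (j - (b : ℕ)),
      E D 0 j (x j ^ (a : ℕ) * (PowerSeries.coeff q.1 (ES x (Finset.range (j + 1))) *
        PowerSeries.coeff q.2 (G (x j)))) =
      PowerSeries.coeff q.1 (ES x (Finset.range (j + 1))) *
        PowerSeries.coeff q.2 (PowerSeries.X ^ (j - (a : ℕ)) * HS x (Finset.range (j + 1))) := by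
    intro q _
    have e1 : x j ^ (a : ℕ) * (PowerSeries.coeff q.1 (ES x (Finset.range (j + 1))) *
        PowerSeries.coeff q.2 (G (x j))) = PowerSeries.coeff q.1 (ES x (Finset.range (j + 1))) *
        x j ^ (q.2 + (a : ℕ)) := by
      rw [G, PowerSeries.coeff_mk, pow_add]; ring
    rw [e1, H.E_lin j 0 (by omega) (fun r _ hr => hz _ _ (by omega)), H.E_pow j hj]
    congr 1
    have e2 : (PowerSeries.X : PowerSeries P) ^ j = PowerSeries.X ^ (a : ℕ) * PowerSeries.X ^ (j - (a : ℕ)) := by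
      rw [← pow_add]; congr 1; omega
    rw [e2, mul_assoc, PowerSeries.coeff_X_pow_mul]
  rw [Finset.sum_congr rfl key, ← PowerSeries.coeff_mul]
  have e3 := HS_mul_ES x (Finset.range (j + 1))
  have e4 : ES x (Finset.range (j + 1)) * (PowerSeries.X ^ (j - (a : ℕ)) * HS x (Finset.range (j + 1)))
      = PowerSeries.X ^ (j - (a : ℕ)) := by
    linear_combination PowerSeries.X ^ (j - (a : ℕ)) * e3
  rw [e4, PowerSeries.coeff_X_pow]
  congr 1
  rw [Fin.ext_iff, eq_iff_iff]
  omega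

/-- The tower of Frobenius extensions. -/
theorem tower (S : Subalgebra k (Module.End k P)) (hS : ∀ r, r + 1 < n → D r ∈ S) : ∀ j, j ≤ n →
    ∃ (ι : Type) (_ : Fintype ι) (_ : DecidableEq ι) (u v : ι → P) (d : Module.End k P),
      Fintype.card ι = j.factorial ∧ d ∈ S ∧
      (∀ r, r + 1 < j → ∀ p, D r (d p) = 0) ∧
      (∀ c, (∀ r, r + 1 < j → D r c = 0) → ∀ p, d (c * p) = c * d p) ∧
      (∀ p, ∑ w, u w * d (v w * p) = p) ∧
      (∀ w w', d (v w * u w') = if w = w' then 1 else 0) := by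
  intro j
  induction j with
  | zero =>
    intro _
    refine ⟨Unit, inferInstance, inferInstance, fun _ => 1, fun _ => 1, 1, by simp, S.one_mem,
      by simp, by simp, by simp, by simp⟩
  | succ j ih =>
    intro hj
    obtain ⟨ι, _, _, u, v, d, hcard, hdS, hd0, hdl, h1, h2⟩ := ih (by omega)
    have hES : ∀ dd i, i + dd < n → E D i dd ∈ S := by
      intro dd
      induction dd with
      | zero => intro i _; exact S.one_mem
      | succ dd ih => intro i h; exact S.mul_mem (hS i (by omega)) (ih (i + 1) (by omega))
    have hx : ∀ a r, r + 1 < j → D r (x j ^ a) = 0 := by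
      intro a r hr
      rw [H.D_zero_iff (by omega), map_pow, H.si (by omega) (by omega) (by omega)]
    have he : ∀ t r, r + 1 < j → D r (PowerSeries.coeff t (ES x (Finset.range j))) = 0 := by
      intro t r hr
      refine H.D_coeff_zero (by omega) (H.ES_fixed (by omega) _ ?_) t
      simp; omega
    refine ⟨ι × Fin (j + 1), inferInstance, inferInstance,
      fun w => u w.1 * PowerSeries.coeff (j - w.2) (ES x (Finset.range j)),
      fun w => v w.1 * x j ^ (w.2 : ℕ), E D 0 j * d, ?_, S.mul_mem (hES j 0 (by omega)) hdS, ?_, ?_, ?_, ?_⟩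
    · rw [Fintype.card_prod, hcard, Fintype.card_fin, Nat.factorial_succ, mul_comm]
    · intro r hr p
      exact H.D_E_zero j (d p) j 0 r (by omega) (by omega) (by omega) (by omega)
        (fun r hr => hd0 r hr p)
    · intro c hc p
      rw [Module.End.mul_apply, Module.End.mul_apply, hdl c (fun r hr => hc r (by omega)),
        H.E_lin j 0 (by omega) (fun r _ hr => hc r (by omega))]
    · intro p
      rw [Fintype.sum_prod_type]
      conv_rhs => rw [← h1 p]
      refine Finset.sum_congr rfl fun w _ => ?_
      rw [← H.dual1 j (by omega) (d (v w * p)) (fun r hr => hd0 r hr _), Finset.mul_sum]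
      refine Finset.sum_congr rfl fun a _ => ?_
      rw [Module.End.mul_apply, ← hdl _ (fun r hr => hx a r hr), ← mul_assoc (u w)]
      congr 3
      ring
    · rintro ⟨w, a⟩ ⟨w', b⟩
      rw [Module.End.mul_apply]
      have e : v w * x j ^ (a : ℕ) * (u w' * PowerSeries.coeff (j - b) (ES x (Finset.range j))) =
          (x j ^ (a : ℕ) * PowerSeries.coeff (j - b) (ES x (Finset.range j))) * (v w * u w') := by ring
      dsimp only
      rw [e, hdl, h2]
      · split_ifs with h3 h4 h4
        · rw [mul_one, H.dual2 j (by omega), if_pos (by simpa using congrArg Prod.snd h4)]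
        · rw [mul_one, H.dual2 j (by omega), if_neg]
          rintro rfl; exact h4 (by rw [h3])
        · exact absurd (congrArg Prod.fst h4) h3
        · simp
      · intro r hr
        rw [H.D_lin (by omega) (hx _ _ hr), he _ _ hr, mul_zero]

end NHD
end NilHecke

namespace NilHecke
section Dim

/-- complete symmetric polynomial of degree m in the variables `X j`, `j ≤ i`. -/
noncomputable def gp (k : Type) [Field k] (n : ℕ) (S : Finset (Fin n)) (m : ℕ) : MvPolynomial (Fin n) k :=
  PowerSeries.coeff m (∏ j ∈ S, (PowerSeries.mk fun m => (X j : MvPolynomial (Fin n) k) ^ m))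

theorem gp_castSucc (k : Type) [Field k] (n : ℕ) (S : Finset (Fin n)) (m : ℕ) :
    gp k (n + 1) (S.map Fin.castSuccEmb) m = rename Fin.castSucc (gp k n S m) := by
  have : PowerSeries.map (rename Fin.castSucc : MvPolynomial (Fin n) k →ₐ[k] _).toRingHom
      (∏ j ∈ S, (PowerSeries.mk fun m => (X j : MvPolynomial (Fin n) k) ^ m)) =
      (∏ j ∈ S.map Fin.castSuccEmb, (PowerSeries.mk fun m => (X j : MvPolynomial (Fin (n+1)) k) ^ m)) := by
    rw [map_prod, Finset.prod_map]
    refine Finset.prod_congr rfl fun j _ => ?_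
    ext1 m
    simp
  rw [gp, ← this, gp, PowerSeries.coeff_map]
  rfl

noncomputable def eqv (k : Type) [Field k] (n : ℕ) :
    MvPolynomial (Fin (n + 1)) k ≃ₐ[k] Polynomial (MvPolynomial (Fin n) k) :=
  (renameEquiv k (finSuccEquivLast (n := n))).trans (optionEquivLeft k (Fin n))

theorem eqv_last (k : Type) [Field k] (n : ℕ) : eqv k n (X (Fin.last n)) = Polynomial.X := by
  simp [eqv, optionEquivLeft_X_none]

theorem eqv_rename (k : Type) [Field k] (n : ℕ) (p : MvPolynomial (Fin n) k) :
    eqv k n (rename Fin.castSucc p) = Polynomial.C p := by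
  have : ((eqv k n).toAlgHom.comp (rename Fin.castSucc)) =
      (IsScalarTower.toAlgHom k (MvPolynomial (Fin n) k) (Polynomial (MvPolynomial (Fin n) k))) := by
    apply MvPolynomial.algHom_ext
    intro i
    simp [eqv, optionEquivLeft_X_some]
  exact DFunLike.congr_fun this p

noncomputable def fp (k : Type) [Field k] (n : ℕ) (m : ℕ) : Polynomial (MvPolynomial (Fin n) k) :=
  eqv k n (gp k (n + 1) Finset.univ m)

theorem fp_eq (k : Type) [Field k] (n m : ℕ) : fp k n m =
    ∑ b ∈ Finset.range (m + 1), Polynomial.C (gp k n Finset.univ (m - b)) * Polynomial.X ^ b := by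
  have : (Finset.univ : Finset (Fin (n + 1))) =
    Finset.cons (Fin.last n) (Finset.univ.map Fin.castSuccEmb) (by simp) := Fin.univ_castSuccEmb n
  rw [fp, gp, this, Finset.prod_cons, PowerSeries.coeff_mul, Finset.Nat.sum_antidiagonal_eq_sum_range_succ_mk,
    map_sum]
  refine Finset.sum_congr rfl fun b _ => ?_
  change eqv k n (_ * gp k (n + 1) (Finset.univ.map Fin.castSuccEmb) (m - b)) = _
  rw [gp_castSucc, map_mul, eqv_rename, PowerSeries.coeff_mk, map_pow, eqv_last, mul_comm]

theorem gp_zero (k : Type) [Field k] (n : ℕ) (S) : gp k n S 0 = 1 := by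
  rw [gp, PowerSeries.coeff_zero_eq_constantCoeff_apply, map_prod]
  apply Finset.prod_eq_one
  intro j _
  rw [← PowerSeries.coeff_zero_eq_constantCoeff_apply]; simp

theorem fp_monic (k : Type) [Field k] (n m : ℕ) : (fp k n m).Monic ∧ (fp k n m).natDegree = m := by
  have h : fp k n m = Polynomial.X ^ m +
    ∑ b ∈ Finset.range m, Polynomial.C (gp k n Finset.univ (m - b)) * Polynomial.X ^ b := by
    rw [fp_eq, Finset.sum_range_succ, Nat.sub_self, gp_zero]; simp [add_comm]
  have hd : (∑ b ∈ Finset.range m, Polynomial.C (gp k n Finset.univ (m - b)) * Polynomial.X ^ b).degree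
      < (m : WithBot ℕ) := by
    refine lt_of_le_of_lt (Polynomial.degree_sum_le _ _) ?_
    refine (Finset.sup_lt_iff (WithBot.bot_lt_coe m)).2 fun b hb => ?_
    refine lt_of_le_of_lt (Polynomial.degree_C_mul_X_pow_le _ _) ?_
    exact WithBot.coe_lt_coe.2 (Finset.mem_range.1 hb)
  constructor
  · rw [h]; exact Polynomial.monic_X_pow_add hd
  · rw [h]; apply Polynomial.natDegree_eq_of_degree_eq_some
    rw [Polynomial.degree_add_eq_left_of_degree_lt] <;> rw [Polynomial.degree_X_pow]
    exact hd

/-- generators -/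
noncomputable def gi (k : Type) [Field k] (n N : ℕ) (i : Fin n) : MvPolynomial (Fin n) k :=
  gp k n (Finset.Iic i) (N - i)

theorem dim_exists (k : Type) [Field k] (N : ℕ) : ∀ n, n ≤ N →
    ∃ (A : Type) (_ : CommRing A) (_ : Algebra k A) (φ : MvPolynomial (Fin n) k →ₐ[k] A),
      Module.Finite k A ∧ Module.finrank k A = N.descFactorial n ∧ Function.Surjective φ ∧
      RingHom.ker φ = Ideal.span (Set.range (gi k n N)) := by
  intro n
  induction n with
  | zero =>
    intro _
    refine ⟨k, inferInstance, inferInstance, (isEmptyAlgEquiv k (Fin 0)).toAlgHom, inferInstance,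
      by simp, (isEmptyAlgEquiv k (Fin 0)).surjective, ?_⟩
    rw [Set.range_eq_empty, Ideal.span_empty]
    exact (RingHom.injective_iff_ker_eq_bot _).1 (isEmptyAlgEquiv k (Fin 0)).injective
  | succ n ih =>
    intro hn
    obtain ⟨A, _, _, φ, hfin, hrank, hsurj, hker⟩ := ih (by omega)
    have hnt : Nontrivial A := by
      apply Module.nontrivial_of_finrank_pos (R := k)
      rw [hrank]; exact Nat.descFactorial_pos.2 (by omega)
    obtain ⟨hm, hdeg⟩ := fp_monic k n (N - n)
    set f := (fp k n (N - n)).map (φ : MvPolynomial (Fin n) k →+* A) with hf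
    have hfm : f.Monic := hm.map _
    have hfd : f.natDegree = N - n := by rw [hf, hm.natDegree_map, hdeg]
    have hfree : Module.Free A (AdjoinRoot f) := hfm.free_adjoinRoot
    have hfinA : Module.Finite A (AdjoinRoot f) := hfm.finite_adjoinRoot
    let ψ : MvPolynomial (Fin (n + 1)) k →ₐ[k] AdjoinRoot f :=
      ((AdjoinRoot.mkₐ f).restrictScalars k).comp ((Polynomial.mapAlgHom φ).comp (eqv k n).toAlgHom)
    have hψ : ∀ p, ψ p = AdjoinRoot.mk f ((eqv k n p).map (φ : MvPolynomial (Fin n) k →+* A)) :=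
      fun p => rfl
    have hmapsurj := Polynomial.map_surjective (φ : MvPolynomial (Fin n) k →+* A) hsurj
    have hlast : gi k (n + 1) N (Fin.last n) = (eqv k n).symm (fp k n (N - n)) := by
      rw [fp, AlgEquiv.symm_apply_apply, gi]
      congr 1
      ext j; simp [Fin.le_last]
    have hcs : ∀ i : Fin n, gi k (n + 1) N i.castSucc = (eqv k n).symm (Polynomial.C (gi k n N i)) := by
      intro i
      rw [← eqv_rename, AlgEquiv.symm_apply_apply, gi, gi, ← gp_castSucc, Fin.map_castSuccEmb_Iic]
      simp
    refine ⟨AdjoinRoot f, inferInstance, inferInstance, ψ, Module.Finite.trans A _, ?_, ?_, ?_⟩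
    · rw [← Module.finrank_mul_finrank k A, hrank, (AdjoinRoot.powerBasis' hfm).finrank,
        AdjoinRoot.powerBasis'_dim, hfd, Nat.descFactorial_succ, mul_comm]
    · intro y
      obtain ⟨q, rfl⟩ := AdjoinRoot.mk_surjective y
      obtain ⟨q, rfl⟩ := hmapsurj q
      exact ⟨(eqv k n).symm q, by rw [hψ]; simp⟩
    · apply le_antisymm
      · intro p hp
        have hp' : ψ p = 0 := hp
        rw [hψ, AdjoinRoot.mk_eq_zero] at hp'
        obtain ⟨q, hq⟩ := hp'
        obtain ⟨Q, rfl⟩ := hmapsurj q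
        have h1 : eqv k n p - fp k n (N - n) * Q ∈ RingHom.ker
            (Polynomial.mapRingHom (φ : MvPolynomial (Fin n) k →+* A)) := by
          rw [RingHom.mem_ker, Polynomial.coe_mapRingHom, Polynomial.map_sub, hq, Polynomial.map_mul,
            ← hf, sub_self]
        rw [Polynomial.ker_mapRingHom] at h1
        have h2 : RingHom.ker (φ : MvPolynomial (Fin n) k →+* A) = Ideal.span (Set.range (gi k n N)) := hker
        rw [h2, Ideal.map_span] at h1
        have h3 := Ideal.mem_map_of_mem ((eqv k n).symm : _ →+* MvPolynomial (Fin (n + 1)) k) h1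
        rw [Ideal.map_span] at h3
        have h4 : p = ((eqv k n).symm : _ →+* MvPolynomial (Fin (n + 1)) k) (eqv k n p - fp k n (N - n) * Q)
            + gi k (n + 1) N (Fin.last n) * (eqv k n).symm Q := by
          rw [hlast]; simp
        rw [h4]
        refine Ideal.add_mem _ (Ideal.span_mono ?_ h3) (Ideal.mul_mem_right _ _ (Ideal.subset_span ⟨_, rfl⟩))
        rintro _ ⟨_, ⟨_, ⟨i, rfl⟩, rfl⟩, rfl⟩
        exact ⟨i.castSucc, hcs i⟩
      · rw [Ideal.span_le]
        rintro _ ⟨i, rfl⟩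
        change ψ _ = 0
        rw [hψ]
        induction i using Fin.lastCases with
        | last => rw [hlast, AlgEquiv.apply_symm_apply, ← hf, AdjoinRoot.mk_self]
        | cast i =>
          rw [hcs, AlgEquiv.apply_symm_apply, Polynomial.map_C]
          have : gi k n N i ∈ RingHom.ker φ := by rw [hker]; exact Ideal.subset_span ⟨i, rfl⟩
          have : φ (gi k n N i) = 0 := this
          simp [this]

theorem dim_quot (k : Type) [Field k] (n N : ℕ) (h : n ≤ N) :
    Module.Finite k (MvPolynomial (Fin n) k ⧸ Ideal.span (Set.range (gi k n N))) ∧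
    Module.finrank k (MvPolynomial (Fin n) k ⧸ Ideal.span (Set.range (gi k n N))) =
      N.descFactorial n := by
  obtain ⟨A, _, _, φ, hfin, hrank, hsurj, hker⟩ := dim_exists k N n h
  rw [← hker]
  let e := (Ideal.quotientKerAlgEquivOfSurjective hsurj).toLinearEquiv
  exact ⟨Module.Finite.equiv e.symm, by rw [← hrank]; exact e.finrank_eq⟩

end Dim
end NilHecke

namespace NilHecke
section Inst
variable (k : Type) [Field k] (n : ℕ)

noncomputable def xx (i : ℕ) : MvPolynomial (Fin n) k := if h : i < n then X ⟨i, h⟩ else 0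

noncomputable def ss (r : ℕ) : MvPolynomial (Fin n) k →ₐ[k] MvPolynomial (Fin n) k :=
  if hr : r + 1 < n then
    rename (⇑(Equiv.swap (⟨r, Nat.lt_of_succ_lt hr⟩ : Fin n) (⟨r + 1, hr⟩ : Fin n)))
  else AlgHom.id k _

noncomputable def DD (D : ∀ r : ℕ, r + 1 < n → Module.End k (MvPolynomial (Fin n) k)) (r : ℕ) :
    Module.End k (MvPolynomial (Fin n) k) := if hr : r + 1 < n then - D r hr else 0

theorem xx_fin (i : Fin n) : xx k n i = X i := by simp [xx]

theorem ss_xx {r : ℕ} (hr : r + 1 < n) (i : ℕ) : ss k n r (xx k n i) = xx k n (Equiv.swap r (r + 1) i) := by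
  rw [ss, dif_pos hr]
  by_cases hi : i < n
  · have h1 : xx k n i = X ⟨i, hi⟩ := by simp [xx, hi]
    rw [h1, rename_X]
    rcases eq_or_ne i r with rfl | h1
    · rw [Equiv.swap_apply_left, Equiv.swap_apply_left]; simp [xx, hr]
    rcases eq_or_ne i (r + 1) with rfl | h2
    · rw [Equiv.swap_apply_right, Equiv.swap_apply_right]; simp [xx, Nat.lt_of_succ_lt hr]
    rw [Equiv.swap_apply_of_ne_of_ne h1 h2,
      Equiv.swap_apply_of_ne_of_ne (by simpa [Fin.ext_iff] using h1) (by simpa [Fin.ext_iff] using h2)]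
    simp [xx, hi]
  · rw [Equiv.swap_apply_of_ne_of_ne (by omega) (by omega)]
    simp [xx, hi]

theorem swap_braid (r i : ℕ) :
    Equiv.swap r (r + 1) (Equiv.swap (r + 1) (r + 1 + 1) (Equiv.swap r (r + 1) i)) =
    Equiv.swap (r + 1) (r + 1 + 1) (Equiv.swap r (r + 1) (Equiv.swap (r + 1) (r + 1 + 1) i)) := by
  have a1 : Equiv.swap r (r + 1) (r + 1 + 1) = r + 1 + 1 :=
    Equiv.swap_apply_of_ne_of_ne (by omega) (by omega)
  have a2 : Equiv.swap (r + 1) (r + 1 + 1) r = r :=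
    Equiv.swap_apply_of_ne_of_ne (by omega) (by omega)
  rcases eq_or_ne i r with rfl | h0
  · simp only [Equiv.swap_apply_left, a1, a2]
  rcases eq_or_ne i (r + 1) with rfl | h1
  · simp only [Equiv.swap_apply_left, Equiv.swap_apply_right, a1, a2]
  rcases eq_or_ne i (r + 1 + 1) with rfl | h2
  · simp only [Equiv.swap_apply_right, a1, a2]
  simp only [Equiv.swap_apply_of_ne_of_ne h0 h1, Equiv.swap_apply_of_ne_of_ne h1 h2]

theorem nhd (D : ∀ r : ℕ, r + 1 < n → Module.End k (MvPolynomial (Fin n) k))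
    (hD : ∀ (r : ℕ) (hr : r + 1 < n) (P : MvPolynomial (Fin n) k),
      (X (⟨r, Nat.lt_of_succ_lt hr⟩ : Fin n) - X (⟨r + 1, hr⟩ : Fin n)) * D r hr P =
        P - rename (⇑(Equiv.swap (⟨r, Nat.lt_of_succ_lt hr⟩ : Fin n)
            (⟨r + 1, hr⟩ : Fin n))) P) : NHD n (xx k n) (ss k n) (DD k n D) where
  hD r hr p := by
    have := hD r hr p
    have e1 : xx k n r = X ⟨r, Nat.lt_of_succ_lt hr⟩ := by simp [xx, Nat.lt_of_succ_lt hr]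
    have e2 : xx k n (r + 1) = X ⟨r + 1, hr⟩ := by simp [xx, hr]
    rw [e1, e2, DD, dif_pos hr, ss, dif_pos hr, ← this, LinearMap.neg_apply]
    ring
  hs r hr i := ss_xx k n hr i
  hne i j hij hj := by
    have e1 : xx k n i = X ⟨i, by omega⟩ := by simp [xx, show i < n by omega]
    have e2 : xx k n j = X ⟨j, hj⟩ := by simp [xx, hj]
    rw [e1, e2, sub_ne_zero]
    intro h
    have := MvPolynomial.X_injective h
    simp [Fin.ext_iff] at this
    omega
  hss r hr p := by
    have : (ss k n r).comp (ss k n r) = AlgHom.id k _ := by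
      apply MvPolynomial.algHom_ext
      intro i
      rw [AlgHom.comp_apply, ← xx_fin, ss_xx k n hr, ss_xx k n hr, Equiv.swap_apply_self]; rfl
    exact DFunLike.congr_fun this p
  hfar r t h ht p := by
    have hr : r + 1 < n := by omega
    have : (ss k n r).comp (ss k n t) = (ss k n t).comp (ss k n r) := by
      apply MvPolynomial.algHom_ext
      intro i
      rw [AlgHom.comp_apply, AlgHom.comp_apply, ← xx_fin, ss_xx k n hr, ss_xx k n ht, ss_xx k n hr,
        ss_xx k n ht]
      congr 1
      simp only [Equiv.swap_apply_def]
      split_ifs <;> omega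
    exact DFunLike.congr_fun this p
  hbraid r hr2 p := by
    have hr : r + 1 < n := by omega
    have ht : r + 1 + 1 < n := by omega
    have : (ss k n r).comp ((ss k n (r + 1)).comp (ss k n r)) =
        (ss k n (r + 1)).comp ((ss k n r).comp (ss k n (r + 1))) := by
      apply MvPolynomial.algHom_ext
      intro i
      simp only [AlgHom.comp_apply, ← xx_fin, ss_xx k n hr, ss_xx k n ht]
      rw [swap_braid]
    exact DFunLike.congr_fun this p

theorem gi_eq (N : ℕ) (i : Fin n) : gi k n N i =
    PowerSeries.coeff (N - i) (HS (xx k n) (Finset.range (i + 1))) := by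
  rw [gi, gp, HS]
  congr 1
  have : Finset.range ((i : ℕ) + 1) = (Finset.Iic i).map Fin.valEmbedding := by
    rw [Fin.map_valEmbedding_Iic]; ext a; simp
  rw [this, Finset.prod_map]
  refine Finset.prod_congr rfl fun j _ => ?_
  change _ = G (xx k n j)
  rw [xx_fin]; rfl

end Inst
end NilHecke

/-- The cyclotomic nil-Hecke algebra `NH_n^N` — the quotient of the nil-Hecke algebra
`NH_n` (the subalgebra of `End(k[X_1,...,X_n])` generated by the multiplication operators
`X_i` and the Demazure operators `∂_r`) by the two-sided ideal generated by `X_1^N` —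
has dimension `n!·N!/(N-n)! = (n!)²·C(N,n)` over `k` when `n ≤ N`. -/
theorem stmt_12 (k : Type) [Field k] [CharZero k] (n N : ℕ) (hn : 0 < n) (hnN : n ≤ N)
    (D : ∀ r : ℕ, r + 1 < n → Module.End k (MvPolynomial (Fin n) k))
    (hD : ∀ (r : ℕ) (hr : r + 1 < n) (P : MvPolynomial (Fin n) k),
      (X (⟨r, Nat.lt_of_succ_lt hr⟩ : Fin n) - X (⟨r + 1, hr⟩ : Fin n)) * D r hr P =
        P - rename (⇑(Equiv.swap (⟨r, Nat.lt_of_succ_lt hr⟩ : Fin n)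
            (⟨r + 1, hr⟩ : Fin n))) P) :
    Module.finrank k
      (RingQuot (fun a b :
          ↥(Algebra.adjoin k
            ((Set.range fun i : Fin n =>
                (LinearMap.mulLeft k (X i) : Module.End k (MvPolynomial (Fin n) k))) ∪
              {f : Module.End k (MvPolynomial (Fin n) k) | ∃ r, ∃ hr : r + 1 < n, f = D r hr})) =>
        (a : Module.End k (MvPolynomial (Fin n) k)) =
            (LinearMap.mulLeft k (X (⟨0, hn⟩ : Fin n)) :
              Module.End k (MvPolynomial (Fin n) k)) ^ N ∧
          b = 0)) =
      Nat.factorial n ^ 2 * Nat.choose N n := by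
  classical
  set A := Algebra.adjoin k
            ((Set.range fun i : Fin n =>
                (LinearMap.mulLeft k (X i) : Module.End k (MvPolynomial (Fin n) k))) ∪
              {f : Module.End k (MvPolynomial (Fin n) k) | ∃ r, ∃ hr : r + 1 < n, f = D r hr}) with hA
  have H := NilHecke.nhd k n D hD
  set D' := NilHecke.DD k n D with hD'
  set x := NilHecke.xx k n with hx
  have hDA : ∀ r, r + 1 < n → D' r ∈ A := by
    intro r hr
    rw [hD', NilHecke.DD, dif_pos hr]
    exact A.neg_mem (Algebra.subset_adjoin (Or.inr ⟨r, hr, rfl⟩))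
  have hmulA : ∀ p, Algebra.lmul k (MvPolynomial (Fin n) k) p ∈ A := by
    intro p
    induction p using MvPolynomial.induction_on with
    | C a =>
      rw [← MvPolynomial.algebraMap_eq, AlgHom.commutes]
      exact A.algebraMap_mem a
    | add p q hp hq => rw [map_add]; exact A.add_mem hp hq
    | mul_X p i hp =>
      rw [map_mul]
      exact A.mul_mem hp (Algebra.subset_adjoin (Or.inl ⟨i, rfl⟩))
  -- induction principle for elements of the algebra
  have hind : ∀ (p : Module.End k (MvPolynomial (Fin n) k) → Prop),
      (∀ q, p (Algebra.lmul k (MvPolynomial (Fin n) k) q)) →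
      (∀ r, r + 1 < n → p (D' r)) → (∀ f g, p f → p g → p (f + g)) →
      (∀ f g, p f → p g → p (f * g)) → ∀ f ∈ A, p f := by
    intro p h1 h2 h3 h4 f hf
    induction hf using Algebra.adjoin_induction with
    | mem f hf =>
      rcases hf with ⟨i, rfl⟩ | ⟨r, hr, rfl⟩
      · exact h1 (X i)
      · have e : D r hr = Algebra.lmul k (MvPolynomial (Fin n) k) (-1) * D' r := by
          apply LinearMap.ext
          intro q
          rw [hD', NilHecke.DD, dif_pos hr]
          change _ = (-1) * (- D r hr q)
          ring
        rw [e]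
        exact h4 _ _ (h1 _) (h2 r hr)
    | algebraMap a =>
      have := h1 (algebraMap k _ a)
      rwa [AlgHom.commutes] at this
    | add f g _ _ hf hg => exact h3 _ _ hf hg
    | mul f g _ _ hf hg => exact h4 _ _ hf hg
  have hlin : ∀ f ∈ A, ∀ c, (∀ r, r + 1 < n → D' r c = 0) → ∀ q, f (c * q) = c * f q := by
    apply hind
    · intro p c _ q
      change p * (c * q) = c * (p * q)
      ring
    · intro r hr c hc q
      exact H.D_lin hr (hc r hr) q
    · intro f g hf hg c hc q
      rw [LinearMap.add_apply, LinearMap.add_apply, hf c hc, hg c hc, mul_add]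
    · intro f g hf hg c hc q
      rw [Module.End.mul_apply, Module.End.mul_apply, hg c hc, hf c hc]
  set J := Ideal.span (Set.range (NilHecke.gi k n N)) with hJ
  have hgi : ∀ i : Fin n, NilHecke.gi k n N i ∈ J := fun i => Ideal.subset_span ⟨i, rfl⟩
  have hDg : ∀ i : ℕ, i + 1 < n → D' i (PowerSeries.coeff (N - i) (NilHecke.HS x (Finset.range (i + 1)))) =
      - PowerSeries.coeff (N - (i + 1)) (NilHecke.HS x (Finset.range (i + 1 + 1))) := by
    intro i hi
    have h := H.D_HS_left hi (Finset.range i) (by simp) (by simp) (N - (i + 1))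
    have e1 : N - (i + 1) + 1 = N - i := by omega
    have e2 : insert i (Finset.range i) = Finset.range (i + 1) := by ext a; simp; omega
    have e3 : insert i (insert (i + 1) (Finset.range i)) = Finset.range (i + 1 + 1) := by
      ext a; simp; omega
    rwa [e1, e2, e3] at h
  have hstab : ∀ f ∈ A, ∀ q ∈ J, f q ∈ J := by
    apply hind
    · intro p q hq
      exact J.mul_mem_left p hq
    · intro r hr q hq
      induction hq using Submodule.span_induction with
      | mem q hq =>
        obtain ⟨i, rfl⟩ := hq
        rw [NilHecke.gi_eq, ← hx]
        by_cases hri : r = i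
        · subst hri
          rw [hDg _ hr]
          have := hgi ⟨(i : ℕ) + 1, hr⟩
          rw [NilHecke.gi_eq] at this
          exact J.neg_mem this
        · rw [H.D_coeff_zero hr (H.HS_fixed hr _ (by simp; omega))]
          exact J.zero_mem
      | zero => rw [map_zero]; exact J.zero_mem
      | add p q _ _ hp hq => rw [map_add]; exact J.add_mem hp hq
      | smul c q hq' hq =>
        rw [smul_eq_mul, H.leib hr]
        exact J.add_mem (J.mul_mem_left _ hq') (J.mul_mem_left _ hq)
    · intro f g hf hg q hq
      exact J.add_mem (hf q hq) (hg q hq)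
    · intro f g hf hg q hq
      exact hf _ (hg q hq)
  have hg0 : PowerSeries.coeff (N - 0) (NilHecke.HS x (Finset.range (0 + 1))) =
      (X (⟨0, hn⟩ : Fin n) : MvPolynomial (Fin n) k) ^ N := by
    simp [NilHecke.HS, NilHecke.G, hx, NilHecke.xx, hn]
  have hθ : ∀ i, i < n → ∃ θ ∈ A, θ ((X (⟨0, hn⟩ : Fin n) : MvPolynomial (Fin n) k) ^ N) =
      PowerSeries.coeff (N - i) (NilHecke.HS x (Finset.range (i + 1))) := by
    intro i
    induction i with
    | zero => intro _; exact ⟨1, A.one_mem, hg0.symm⟩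
    | succ i ih =>
      intro hi
      obtain ⟨θ, hθ, h⟩ := ih (by omega)
      refine ⟨- (D' i * θ), A.neg_mem (A.mul_mem (hDA i hi) hθ), ?_⟩
      rw [LinearMap.neg_apply, Module.End.mul_apply, h, hDg i hi, neg_neg]
  obtain ⟨ι, _, _, u, v, d, hcard, hdA, hd0, hdl, h1, h2⟩ := H.tower A hDA n le_rfl
  obtain ⟨hfin, hrank⟩ := NilHecke.dim_quot k n N hnN
  have hzA : (LinearMap.mulLeft k (X (⟨0, hn⟩ : Fin n)) :
              Module.End k (MvPolynomial (Fin n) k)) ^ N ∈ A :=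
    A.pow_mem (hmulA (X (⟨0, hn⟩ : Fin n))) N
  have hz : ∀ q, ((LinearMap.mulLeft k (X (⟨0, hn⟩ : Fin n)) :
              Module.End k (MvPolynomial (Fin n) k)) ^ N) q = X (⟨0, hn⟩ : Fin n) ^ N * q := by
    intro q
    rw [LinearMap.pow_mulLeft]; rfl
  have key := NilHecke.finrank_ringQuot (k := k) (S := ↥A) (P := MvPolynomial (Fin n) k) A.val
    Subtype.val_injective (fun a b : ↥A => (a : Module.End k (MvPolynomial (Fin n) k)) =
            (LinearMap.mulLeft k (X (⟨0, hn⟩ : Fin n)) :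
              Module.End k (MvPolynomial (Fin n) k)) ^ N ∧
          b = 0) ⟨_, hzA⟩ (fun a b => and_congr_left' ⟨fun h => Subtype.ext h, fun h => congrArg Subtype.val h⟩) J u v ⟨d, hdA⟩
    ((Algebra.lmul k (MvPolynomial (Fin n) k)).codRestrict A hmulA).toLinearMap
    (fun p q => rfl) h1 h2
    (fun f p q => hlin f.1 f.2 _ (fun r hr => hd0 r hr p) q)
    (fun f q hq => hstab f.1 f.2 q hq)
    (fun q => by
      change ((LinearMap.mulLeft k (X (⟨0, hn⟩ : Fin n)) :
              Module.End k (MvPolynomial (Fin n) k)) ^ N) q ∈ J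
      rw [hz, ← hg0]
      have := hgi ⟨0, hn⟩
      rw [NilHecke.gi_eq] at this
      exact J.mul_mem_right q this)
    (by
      intro q hq
      induction hq using Submodule.span_induction with
      | mem q hq =>
        obtain ⟨i, rfl⟩ := hq
        obtain ⟨θ, hθA, hθ⟩ := hθ i i.2
        have e : ((Algebra.lmul k (MvPolynomial (Fin n) k)).codRestrict A hmulA).toLinearMap
            (NilHecke.gi k n N i) * (⟨d, hdA⟩ : ↥A) = (⟨θ, hθA⟩ : ↥A) * (⟨_, hzA⟩ : ↥A) * ⟨d, hdA⟩ := by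
          apply Subtype.ext
          apply LinearMap.ext
          intro p
          change NilHecke.gi k n N i * d p = θ (((LinearMap.mulLeft k (X (⟨0, hn⟩ : Fin n)) :
              Module.End k (MvPolynomial (Fin n) k)) ^ N) (d p))
          rw [hz, mul_comm (X _ ^ N), hlin θ hθA _ (fun r hr => hd0 r hr p), hθ, NilHecke.gi_eq, mul_comm]
        rw [e, map_mul, map_mul]
        have e0 := RingQuot.mkAlgHom_rel k (s := fun a b : ↥A => (a : Module.End k (MvPolynomial (Fin n) k)) =
            (LinearMap.mulLeft k (X (⟨0, hn⟩ : Fin n)) :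
              Module.End k (MvPolynomial (Fin n) k)) ^ N ∧
          b = 0) (x := ⟨_, hzA⟩) (y := 0) ⟨rfl, rfl⟩
        rw [e0, map_zero, mul_zero, zero_mul]
      | zero => rw [map_zero, zero_mul, map_zero]
      | add p q _ _ hp hq => rw [map_add, add_mul, map_add, hp, hq, add_zero]
      | smul c q _ hq =>
        have e : ((Algebra.lmul k (MvPolynomial (Fin n) k)).codRestrict A hmulA).toLinearMap (c • q) =
            ((Algebra.lmul k (MvPolynomial (Fin n) k)).codRestrict A hmulA).toLinearMap c *
            ((Algebra.lmul k (MvPolynomial (Fin n) k)).codRestrict A hmulA).toLinearMap q :=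
          map_mul ((Algebra.lmul k (MvPolynomial (Fin n) k)).codRestrict A hmulA) c q
        rw [e, mul_assoc, map_mul, hq, mul_zero])
  rw [hrank, hcard, Nat.descFactorial_eq_factorial_mul_choose] at key
  rw [sq, mul_assoc]
  exact key
end
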